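/- Let μ be an acyclic partial matching on a finite graded poset P and let γ₁, γ₂, γ₃ be flow paths with ι(γ₂) < τ(γ₁) and ι(γ₃) < τ(γ₂). Then r(γ₁ * γ₂) and γ₃ are composable, γ₁ and r(γ₂ * γ₃) are composable, and r(r(γ₁ * γ₂) * γ₃) = r(γ₁ * r(γ₂ * γ₃)). (Consequently the reduced composition δ ∘ γ := r(γ * δ) on reduced flow paths is associative.) -/

import Mathlib

/-- A partial matching on a poset `P`: a bijection `μ : D → U` between disjoint
subsets `D, U ⊆ P` such that `d ⋖ μ d` for every `d ∈ D`. -/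
structure PartialMatching (P : Type) [PartialOrder P] where
  D : Set P
  U : Set P
  m : P → P
  minv : P → P
  disj : Disjoint D U
  m_mem : ∀ d ∈ D, m d ∈ U
  minv_mem : ∀ u ∈ U, minv u ∈ D
  left_inv : ∀ d ∈ D, minv (m d) = d
  right_inv : ∀ u ∈ U, m (minv u) = u
  cov : ∀ d ∈ D, d ⋖ m d

namespace PartialMatching

variable {P : Type} [PartialOrder P]

/-- The set of critical elements. -/
def Cr (M : PartialMatching P) : Set P := (M.D ∪ M.U)ᶜ

/-- A partial matching is acyclic if every Forman path is a gradient path. -/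
def IsAcyclic (M : PartialMatching P) : Prop :=
  ∀ (n : ℕ) (d : ℕ → P), 1 ≤ n →
    (∀ i j, i < n → j < n → d i = d j → i = j) →
    (∀ i, i < n → d i ∈ M.D) →
    (∀ i, i + 1 < n → d (i + 1) ⋖ M.m (d i)) →
    n = 1 ∨ ¬ d 0 ⋖ M.m (d (n - 1))

/-- A faithful discrete Morse function adapted to `M`. -/
def Faithful (M : PartialMatching P) (f : P → ℤ) : Prop :=
  Function.Injective f ∧
  (∀ d ∈ M.D, f (M.m d) < f d) ∧
  ∀ e e' : P, e < e' → ¬(e ∈ M.D ∧ e' = M.m e) → f e < f e'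

end PartialMatching

/-- The data of a flow path `(e₁,u₁,…,e_n,u_n;c)`: the list of pairs
`steps = [(e₁,u₁),…,(e_n,u_n)]` and the final (critical) cell `c`. -/
structure FlowPath (P : Type) where
  steps : List (P × P)
  c : P

namespace FlowPath

variable {P : Type} [PartialOrder P]

/-- The length `ℓ(γ) = n` of a flow path. -/
def len (γ : FlowPath P) : ℕ := γ.steps.length

/-- `eAt γ i = e_{i+1}` (0-based); by convention `eAt γ i = c` for `i ≥ len γ`. -/
def eAt (γ : FlowPath P) (i : ℕ) : P := (γ.steps.map Prod.fst).getD i γ.c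

/-- `uAt γ i = u_{i+1}` (0-based). -/
def uAt (γ : FlowPath P) (i : ℕ) : P := (γ.steps.map Prod.snd).getD i γ.c

/-- The initial cell `ι(γ)` (equal to `c` when `len γ = 0`). -/
def init (γ : FlowPath P) : P := γ.eAt 0

/-- The target `τ(γ) = c`. -/
def tgt (γ : FlowPath P) : P := γ.c

/-- `γ` is a genuine flow path with respect to the matching `M`. -/
def Valid (M : PartialMatching P) (γ : FlowPath P) : Prop :=
  γ.c ∈ M.Cr ∧
  ∀ i, i < γ.len →
    γ.uAt i ∈ M.U ∧
    (γ.eAt i = γ.uAt i ∨ γ.eAt i = M.minv (γ.uAt i)) ∧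
    γ.eAt (i + 1) < γ.uAt i ∧
    γ.eAt (i + 1) ≠ M.minv (γ.uAt i)

/-- `φ : {0,…,k} → {0,…,ℓ(γ')+1}` is an embedding function for `γ ⪯ γ'`.
Indices of cells are 1-based as in the paper, so the paper's `e_j` is `eAt γ (j-1)`. -/
def IsEmbed (γ γ' : FlowPath P) (k : ℕ) (φ : ℕ → ℕ) : Prop :=
  1 ≤ k ∧ k ≤ γ.len + 1 ∧
  (∀ i j, i < j → j ≤ k → φ i < φ j) ∧
  φ 0 = 0 ∧ φ k = γ'.len + 1 ∧
  (∀ j, 1 ≤ j → j < k → γ.uAt (j - 1) = γ'.uAt (φ j - 1)) ∧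
  (∀ j p, 1 ≤ j → j ≤ k → φ (j - 1) < p → p ≤ φ j → γ.eAt (j - 1) ≤ γ'.eAt (p - 1))

/-- The subpath relation `γ ⪯ γ'`. -/
def Subpath (γ γ' : FlowPath P) : Prop := ∃ k φ, IsEmbed γ γ' k φ

/-- `γ` is reducible at `i` (0-based; the paper's index is `i+1`). -/
def ReducibleAt (M : PartialMatching P) (γ : FlowPath P) (i : ℕ) : Prop :=
  i < γ.len ∧ γ.eAt (i + 1) < M.minv (γ.uAt i)

/-- `γ` is reduced: it is reducible at no index. -/
def Reduced (M : PartialMatching P) (γ : FlowPath P) : Prop :=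
  ∀ i, ¬ ReducibleAt M γ i

/-- Concatenation `γ * δ` of flow paths. -/
def concat (γ δ : FlowPath P) : FlowPath P := ⟨γ.steps ++ δ.steps, δ.c⟩

/-- The collapse `τ(γ ⪯ γ')`: the tail of `γ` starting at its (1-based) `k`-th cell. -/
def collapse (γ : FlowPath P) (k : ℕ) : FlowPath P := ⟨γ.steps.drop (k - 1), γ.c⟩

/-- `rγ` is the reduction of `γ`: the greatest reduced flow path `⪯ γ`. -/
def IsReduction (M : PartialMatching P) (γ rγ : FlowPath P) : Prop :=
  Valid M rγ ∧ Reduced M rγ ∧ Subpath rγ γ ∧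
  ∀ δ, Valid M δ → Reduced M δ → Subpath δ γ → Subpath δ rγ

end FlowPath

namespace PartialMatching

variable {P : Type} [PartialOrder P]

/-- One step of the flow: either from a cell of the matched pair `{minv u, u}` down to another
face of `u`, or from a critical cell down to one of its faces. -/
def FlowStep (M : PartialMatching P) (x y : P) : Prop :=
  (∃ u ∈ M.U, (x = u ∨ x = M.minv u) ∧ y < u ∧ y ≠ M.minv u) ∨ (x ∈ M.Cr ∧ y < x)

/-- Consecutive elements of a Forman path. -/
def FormanStep (M : PartialMatching P) (x y : P) : Prop :=
  x ∈ M.D ∧ y ⋖ M.m x ∧ y ≠ x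

theorem minv_covBy (M : PartialMatching P) {u : P} (hu : u ∈ M.U) : M.minv u ⋖ u := by
  have h := M.cov _ (M.minv_mem u hu)
  rwa [M.right_inv u hu] at h

theorem minv_le_of_eq_or (M : PartialMatching P) {e u : P} (hu : u ∈ M.U)
    (h : e = u ∨ e = M.minv u) : M.minv u ≤ e := by
  rcases h with rfl | rfl
  · exact (M.minv_covBy hu).le
  · exact le_rfl

theorem lt_and_ne_minv_of_le (M : PartialMatching P) {u x y : P} (hu : u ∈ M.U) (hxy : x ≤ y)
    (hy : y < u) (hne : y ≠ M.minv u) : x < u ∧ x ≠ M.minv u := by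
  refine ⟨hxy.trans_lt hy, ?_⟩
  rintro rfl
  exact (M.minv_covBy hu).2 (lt_of_le_of_ne hxy hne.symm) hy

/-- A rank function that increases by one along covers is strictly monotone. -/
theorem lt_of_covBy_succ [Finite P] {rk : P → ℕ} (hrk : ∀ a b : P, a ⋖ b → rk b = rk a + 1)
    {a b : P} (h : a < b) : rk a < rk b := by
  induction b using WellFoundedLT.induction with
  | ind b ih =>
    obtain ⟨c, hac, hcb⟩ := exists_le_covBy_of_lt h
    have := hrk c b hcb
    rcases hac.eq_or_lt with rfl | hac
    · omega
    · have := ih c hcb.lt hac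
      omega

theorem covBy_of_rank_eq [Finite P] {rk : P → ℕ} (hrk : ∀ a b : P, a ⋖ b → rk b = rk a + 1)
    {a b : P} (h : a < b) (hr : rk b = rk a + 1) : a ⋖ b := by
  refine ⟨h, fun c hac hcb => ?_⟩
  have := lt_of_covBy_succ hrk hac
  have := lt_of_covBy_succ hrk hcb
  omega

theorem FlowStep.rank_le [Finite P] {rk : P → ℕ} (hrk : ∀ a b : P, a ⋖ b → rk b = rk a + 1)
    {M : PartialMatching P} {x y : P} (h : M.FlowStep x y) :
    rk y ≤ rk x ∧ (rk y = rk x → M.FormanStep x y) := by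
  rcases h with ⟨u, hu, hx, hy, hne⟩ | ⟨-, hy⟩
  · have h1 := lt_of_covBy_succ hrk hy
    have h2 := hrk _ _ (M.minv_covBy hu)
    rcases hx with rfl | rfl
    · exact ⟨h1.le, fun h => by omega⟩
    · refine ⟨by omega, fun h => ⟨M.minv_mem u hu, ?_, hne⟩⟩
      rw [M.right_inv u hu]
      exact covBy_of_rank_eq hrk hy (by omega)
  · have h1 := lt_of_covBy_succ hrk hy
    exact ⟨h1.le, fun h => by omega⟩

theorem transGen_formanStep_of_rank_eq [Finite P] {rk : P → ℕ}
    (hrk : ∀ a b : P, a ⋖ b → rk b = rk a + 1) {M : PartialMatching P} {x y : P}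
    (h : Relation.TransGen M.FlowStep x y) :
    rk y ≤ rk x ∧ (rk y = rk x → Relation.TransGen M.FormanStep x y) := by
  induction h with
  | single h =>
    have := h.rank_le hrk
    exact ⟨this.1, fun e => .single (this.2 e)⟩
  | tail _ h ih =>
    have := h.rank_le hrk
    exact ⟨by omega, fun e => .tail (ih.2 (by omega)) (this.2 (by omega))⟩

theorem exists_seq_of_transGen {α : Type*} {r : α → α → Prop} {x y : α}
    (h : Relation.TransGen r x y) :
    ∃ (n : ℕ) (d : ℕ → α), 1 ≤ n ∧ d 0 = x ∧ d n = y ∧ ∀ i < n, r (d i) (d (i + 1)) := by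
  induction h using Relation.TransGen.head_induction_on with
  | @single a h =>
    exact ⟨1, fun i => if i = 0 then a else y, le_rfl, rfl, rfl, fun i hi => by
      obtain rfl : i = 0 := by omega
      exact h⟩
  | @head a _ h _ ih =>
    obtain ⟨n, d, hn, h0, hdn, hd⟩ := ih
    refine ⟨n + 1, fun i => Nat.casesOn i a d, by omega, rfl, hdn, ?_⟩
    rintro (_ | i) hi
    · simpa [h0] using h
    · exact hd i (by omega)

theorem IsAcyclic.not_transGen_formanStep {M : PartialMatching P} (hM : M.IsAcyclic) (x : P) :
    ¬ Relation.TransGen M.FormanStep x x := by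
  classical
  intro h
  have hex : ∃ n, ∃ d : ℕ → P, 1 ≤ n ∧ d 0 = d n ∧ ∀ i < n, M.FormanStep (d i) (d (i + 1)) := by
    obtain ⟨n, d, hn, h0, hdn, hd⟩ := exists_seq_of_transGen h
    exact ⟨n, d, hn, h0.trans hdn.symm, hd⟩
  obtain ⟨d, hn, h0, hd⟩ := Nat.find_spec hex
  set n := Nat.find hex
  have hinj : ∀ i j, i < j → j < n → d i ≠ d j := by
    intro i j hij hj heq
    refine Nat.find_min hex (m := j - i) (by omega)
      ⟨fun k => d (i + k), by omega, ?_, fun k hk => hd _ (by omega)⟩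
    simpa [Nat.add_sub_cancel' hij.le] using heq
  have hlast := hd (n - 1) (by omega)
  rw [Nat.sub_add_cancel hn, ← h0] at hlast
  rcases hM n d hn
    (fun i j hi hj heq => by
      rcases lt_trichotomy i j with h | h | h
      · exact (hinj i j h hj heq).elim
      · exact h
      · exact (hinj j i h hi heq.symm).elim)
    (fun i hi => (hd i hi).1) (fun i hi => (hd i (by omega)).2.1) with h1 | h1
  · exact hlast.2.2 (by rw [h1])
  · exact h1 hlast.2.1

theorem IsAcyclic.not_transGen_flowStep [Finite P] {rk : P → ℕ}
    (hrk : ∀ a b : P, a ⋖ b → rk b = rk a + 1) {M : PartialMatching P} (hM : M.IsAcyclic) (x : P) :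
    ¬ Relation.TransGen M.FlowStep x x :=
  fun h => hM.not_transGen_formanStep x ((transGen_formanStep_of_rank_eq hrk h).2 rfl)

end PartialMatching

namespace FlowPath

variable {P : Type}

/-- The initial cell of the flow path `⟨l, c⟩`. -/
def ini (c : P) : List (P × P) → P
  | [] => c
  | s :: _ => s.1

theorem eAt_zero (l : List (P × P)) (c : P) : eAt ⟨l, c⟩ 0 = ini c l := by
  cases l <;> rfl

theorem init_mk (l : List (P × P)) (c : P) : init ⟨l, c⟩ = ini c l := eAt_zero l c

theorem uAt_cons_zero (s : P × P) (l : List (P × P)) (c : P) : uAt ⟨s :: l, c⟩ 0 = s.2 := rfl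

theorem len_cons (s : P × P) (l : List (P × P)) (c : P) :
    len ⟨s :: l, c⟩ = len ⟨l, c⟩ + 1 := rfl

variable [PartialOrder P]

/-- Recursive form of `FlowPath.Valid`. -/
def IsFlow (M : PartialMatching P) (c : P) : List (P × P) → Prop
  | [] => c ∈ M.Cr
  | (e, u) :: t =>
    (u ∈ M.U ∧ (e = u ∨ e = M.minv u) ∧ ini c t < u ∧ ini c t ≠ M.minv u) ∧ IsFlow M c t

/-- Recursive form of `FlowPath.Reduced`. -/
def IsRed (M : PartialMatching P) (c : P) : List (P × P) → Prop
  | [] => True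
  | (_, u) :: t => ¬ ini c t < M.minv u ∧ IsRed M c t

/-- Recursive form of `FlowPath.Subpath`: `Sub c c' l' l` says that `⟨l, c⟩ ⪯ ⟨l', c'⟩`. -/
def Sub (c c' : P) : List (P × P) → List (P × P) → Prop
  | [], l => ini c l ≤ c'
  | (e', u') :: t', l =>
    ini c l ≤ e' ∧ (Sub c c' t' l ∨ ∃ e t, l = (e, u') :: t ∧ Sub c c' t' t)

/-- Deletion of one reducible step. -/
inductive RedStep (M : PartialMatching P) (c : P) : List (P × P) → List (P × P) → Prop
  | head (e u : P) (t : List (P × P)) (h : ini c t < M.minv u) : RedStep M c ((e, u) :: t) t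
  | cons (s : P × P) {t t' : List (P × P)} (h : RedStep M c t t') :
      RedStep M c (s :: t) (s :: t')

theorem valid_iff (M : PartialMatching P) (c : P) (l : List (P × P)) :
    Valid M ⟨l, c⟩ ↔ IsFlow M c l := by
  induction l with
  | nil => exact ⟨fun h => h.1, fun h => ⟨h, fun i hi => absurd hi (Nat.not_lt_zero i)⟩⟩
  | cons s t ih =>
    rw [IsFlow, ← ih, ← eAt_zero]
    constructor
    · rintro ⟨hc, h⟩
      exact ⟨h 0 (Nat.succ_pos _), hc, fun i hi => h (i + 1) (Nat.succ_lt_succ hi)⟩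
    · rintro ⟨h0, hc, h⟩
      refine ⟨hc, ?_⟩
      rintro (_ | i) hi
      · exact h0
      · exact h i (Nat.lt_of_succ_lt_succ hi)

theorem reduced_iff (M : PartialMatching P) (c : P) (l : List (P × P)) :
    Reduced M ⟨l, c⟩ ↔ IsRed M c l := by
  induction l with
  | nil => exact ⟨fun _ => trivial, fun _ i hi => absurd hi.1 (Nat.not_lt_zero i)⟩
  | cons s t ih =>
    rw [IsRed, ← ih, ← eAt_zero]
    constructor
    · intro h
      exact ⟨fun h0 => h 0 ⟨Nat.succ_pos _, h0⟩,
        fun i hi => h (i + 1) ⟨Nat.succ_lt_succ hi.1, hi.2⟩⟩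
    · rintro ⟨h0, h⟩ (_ | i) hi
      · exact h0 hi.2
      · exact h i ⟨Nat.lt_of_succ_lt_succ hi.1, hi.2⟩

theorem sub_of_isEmbed {c c' : P} {l' l : List (P × P)} {k : ℕ} {φ : ℕ → ℕ}
    (h : IsEmbed ⟨l, c⟩ ⟨l', c'⟩ k φ) : Sub c c' l' l := by
  induction l' generalizing l k φ with
  | nil =>
    obtain ⟨hk, -, hφ, h0, hφk, -, he⟩ := h
    have := hφ 0 1 one_pos hk
    have := he 1 1 le_rfl hk (by simp [h0]) (by omega)
    rwa [eAt_zero, eAt_zero] at this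
  | cons s t ih =>
    obtain ⟨hk, hkl, hφ, h0, hφk, hu, he⟩ := h
    have h01 := hφ 0 1 one_pos hk
    have he1 := he 1 1 le_rfl hk (by simp [h0]) (by omega)
    rw [eAt_zero, eAt_zero] at he1
    rw [len_cons] at hφk
    refine ⟨he1, ?_⟩
    by_cases h1 : φ 1 = 1
    · have hk2 : 2 ≤ k := by
        by_contra hlt
        obtain rfl : k = 1 := by omega
        omega
      cases l with
      | nil => exact absurd hkl (by simp [len]; omega)
      | cons r l =>
        have hur := hu 1 le_rfl (by omega)
        simp only [h1, Nat.sub_self, uAt_cons_zero] at hur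
        rw [len_cons] at hkl
        have hpos : ∀ j, 1 ≤ j → j ≤ k → 1 ≤ φ j := fun j hj hjk => by
          have := hφ 0 j hj hjk
          omega
        refine .inr ⟨r.1, l, by rw [← hur], ih (k := k - 1) (φ := fun j => φ (j + 1) - 1)
          ⟨by omega, by omega, ?_, by simp [h1], ?_, ?_, ?_⟩⟩
        · intro i j hij hj
          have := hφ (i + 1) (j + 1) (by omega) (by omega)
          have := hpos (i + 1) (by omega) (by omega)
          show φ (i + 1) - 1 < φ (j + 1) - 1
          omega
        · show φ (k - 1 + 1) - 1 = _
          rw [Nat.sub_add_cancel hk]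
          omega
        · intro j hj hjk
          obtain ⟨j, rfl⟩ := Nat.exists_eq_add_of_le' hj
          have h2 := hu (j + 2) (by omega) (by omega)
          have h3 := hφ 1 (j + 2) (by omega) (by omega)
          obtain ⟨q, hq⟩ := Nat.exists_eq_add_of_le' (show 2 ≤ φ (j + 2) by omega)
          show uAt _ j = uAt _ (φ (j + 2) - 1 - 1)
          rw [hq] at h2 ⊢
          exact h2
        · intro j p hj hjk hp hpj
          obtain ⟨j, rfl⟩ := Nat.exists_eq_add_of_le' hj
          obtain ⟨p, rfl⟩ := Nat.exists_eq_add_of_le' (show 1 ≤ p by omega)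
          have hp' : φ (j + 1) - 1 < p + 1 := hp
          have hpj' : p + 1 ≤ φ (j + 2) - 1 := hpj
          exact he (j + 2) (p + 2) (by omega) (by omega)
            (show φ (j + 1) < p + 2 by omega) (by omega)
    · refine .inl (ih (k := k) (φ := fun j => φ j - 1)
        ⟨hk, hkl, ?_, by simp [h0], ?_, ?_, ?_⟩)
      · intro i j hij hj
        have := hφ i j hij hj
        show φ i - 1 < φ j - 1
        rcases Nat.eq_zero_or_pos i with rfl | hi
        · rcases (show j = 1 ∨ 1 < j by omega) with rfl | hj1
          · omega
          · have := hφ 1 j hj1 hj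
            omega
        · have := hφ 0 i hi (by omega)
          omega
      · show φ k - 1 = _
        omega
      · intro j hj hjk
        have h2 := hu j hj hjk
        have h3 : 2 ≤ φ j := by
          rcases (show j = 1 ∨ 1 < j by omega) with rfl | hj1
          · omega
          · have := hφ 1 j hj1 hjk.le
            omega
        obtain ⟨q, hq⟩ := Nat.exists_eq_add_of_le' h3
        show _ = uAt _ (φ j - 1 - 1)
        rw [hq] at h2 ⊢
        exact h2
      · intro j p hj hjk hp hpj
        obtain ⟨p, rfl⟩ := Nat.exists_eq_add_of_le' (show 1 ≤ p by omega)
        have hp' : φ (j - 1) - 1 < p + 1 := hp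
        have hpj' : p + 1 ≤ φ j - 1 := hpj
        exact he j (p + 2) hj hjk (by omega) (by omega)

theorem Sub.subpath {c c' : P} {l' l : List (P × P)} (h : Sub c c' l' l) :
    Subpath ⟨l, c⟩ ⟨l', c'⟩ := by
  induction l' generalizing l with
  | nil =>
    refine ⟨1, id, le_rfl, by simp, fun i j hij _ => hij, rfl, rfl,
      fun j hj hj' => absurd hj' (by omega), fun j p hj hj' hp hp' => ?_⟩
    obtain rfl : j = 1 := by omega
    obtain rfl : p = 1 := by simp at hp hp'; omega
    rw [eAt_zero, eAt_zero]
    exact h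
  | cons s t ih =>
    obtain ⟨h1, h | ⟨e, l, rfl, h⟩⟩ := h
    · obtain ⟨k, φ, hk, hkl, hφ, h0, hφk, hu, he⟩ := ih h
      have hpos : ∀ j, 1 ≤ j → j ≤ k → 1 ≤ φ j := fun j hj hjk => by
        have := hφ 0 j hj hjk
        omega
      refine ⟨k, fun j => if j = 0 then 0 else φ j + 1, hk, hkl, ?_, rfl, ?_, ?_, ?_⟩
      · intro i j hij hj
        have := hφ i j hij hj
        dsimp only
        split_ifs <;> omega
      · rw [len_cons, ← hφk]
        exact if_neg (by omega)
      · intro j hj hjk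
        have h2 := hu j hj hjk
        obtain ⟨q, hq⟩ := Nat.exists_eq_add_of_le' (hpos j hj hjk.le)
        dsimp only
        rw [if_neg (by omega), h2, hq]
        rfl
      · intro j p hj hjk hp hpj
        dsimp only at hpj
        rw [if_neg (by omega)] at hpj
        rcases (show p ≤ 1 ∨ 2 ≤ p by omega) with hp1 | hp1
        · have hj1 : j = 1 := by
            by_contra hne
            have := hpos (j - 1) (by omega) (by omega)
            dsimp only at hp
            split_ifs at hp <;> omega
          obtain rfl := hj1
          rw [show p - 1 = 0 by omega, eAt_zero, eAt_zero]
          exact h1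
        · obtain ⟨p, rfl⟩ := Nat.exists_eq_add_of_le' hp1
          refine he j (p + 1) hj hjk ?_ (by omega)
          dsimp only at hp
          split_ifs at hp with hj0
          · rw [hj0, h0]
            omega
          · omega
    · obtain ⟨k, φ, hk, hkl, hφ, h0, hφk, hu, he⟩ := ih h
      refine ⟨k + 1, fun j => if j = 0 then 0 else φ (j - 1) + 1, by omega,
        by rw [len_cons]; omega, ?_, rfl, ?_, ?_, ?_⟩
      · intro i j hij hj
        dsimp only
        split_ifs with hi hj0 hj0
        · omega
        · omega
        · omega
        · have := hφ (i - 1) (j - 1) (by omega) (by omega)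
          omega
      · rw [len_cons, ← hφk]
        exact if_neg (by omega)
      · intro j hj hjk
        dsimp only
        rw [if_neg (by omega)]
        obtain ⟨j, rfl⟩ := Nat.exists_eq_add_of_le' hj
        simp only [Nat.add_sub_cancel]
        cases j with
        | zero => rw [h0]; rfl
        | succ j =>
          have h2 := hu (j + 1) (by omega) (by omega)
          have := hφ 0 (j + 1) (by omega) (by omega)
          obtain ⟨q, hq⟩ := Nat.exists_eq_add_of_le' (show 1 ≤ φ (j + 1) by omega)
          rw [hq] at h2 ⊢
          exact h2
      · intro j p hj hjk hp hpj
        dsimp only at hpj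
        rw [if_neg (by omega)] at hpj
        obtain ⟨j, rfl⟩ := Nat.exists_eq_add_of_le' hj
        simp only [Nat.add_sub_cancel] at hp hpj ⊢
        cases j with
        | zero =>
          rw [h0] at hpj
          rw [show p - 1 = 0 by omega, eAt_zero, eAt_zero]
          exact h1
        | succ j =>
          rw [if_neg (by omega), Nat.add_sub_cancel] at hp
          obtain ⟨p, rfl⟩ := Nat.exists_eq_add_of_le' (show 2 ≤ p by omega)
          exact he (j + 1) (p + 1) (by omega) (by omega)
            (show φ j < p + 1 by omega) (by omega)

theorem subpath_iff {c c' : P} {l l' : List (P × P)} :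
    Subpath ⟨l, c⟩ ⟨l', c'⟩ ↔ Sub c c' l' l :=
  ⟨fun ⟨_, _, h⟩ => sub_of_isEmbed h, Sub.subpath⟩

theorem Sub.ini_le {c c' : P} {l' l : List (P × P)} (h : Sub c c' l' l) :
    ini c l ≤ ini c' l' := by
  cases l' with
  | nil => exact h
  | cons s t => exact h.1

theorem Sub.refl (c : P) (l : List (P × P)) : Sub c c l l := by
  induction l with
  | nil => exact le_rfl
  | cons s t ih => exact ⟨le_rfl, .inr ⟨_, _, rfl, ih⟩⟩

theorem Sub.trans {c c' c'' : P} {l l' l'' : List (P × P)} (h : Sub c c' l' l)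
    (h' : Sub c' c'' l'' l') : Sub c c'' l'' l := by
  induction l'' generalizing l l' with
  | nil => exact h.ini_le.trans h'
  | cons s t ih =>
    refine ⟨h.ini_le.trans h'.1, ?_⟩
    rcases h'.2 with ht' | ⟨e, t', rfl, ht'⟩
    · exact .inl (ih h ht')
    · rcases h.2 with ht | ⟨e₁, t₁, rfl, ht⟩
      · exact .inl (ih ht ht')
      · exact .inr ⟨e₁, t₁, rfl, ih ht ht'⟩

theorem IsFlow.critical {M : PartialMatching P} {c : P} {l : List (P × P)}
    (h : IsFlow M c l) : c ∈ M.Cr := by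
  induction l with
  | nil => exact h
  | cons s t ih => exact ih h.2

theorem IsFlow.reflTransGen {M : PartialMatching P} {c : P} {l : List (P × P)}
    (h : IsFlow M c l) : Relation.ReflTransGen M.FlowStep (ini c l) c := by
  induction l with
  | nil => exact .refl
  | cons s t ih => exact .head (.inl ⟨s.2, h.1⟩) (ih h.2)

theorem IsFlow.transGen_cons {M : PartialMatching P} {c : P} {s : P × P} {t : List (P × P)}
    (h : IsFlow M c (s :: t)) : Relation.TransGen M.FlowStep s.1 c :=
  .head' (.inl ⟨s.2, h.1⟩) (IsFlow.reflTransGen h.2)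

theorem reflTransGen_of_le {M : PartialMatching P} {c x : P} (hc : c ∈ M.Cr) (h : x ≤ c) :
    Relation.ReflTransGen M.FlowStep c x := by
  rcases h.eq_or_lt with rfl | h
  · exact .refl
  · exact .single (.inr ⟨hc, h⟩)

theorem Sub.reflTransGen {M : PartialMatching P} {c c' : P} {l l' : List (P × P)}
    (h : Sub c c' l' l) (hl : IsFlow M c l) (hc' : c' ∈ M.Cr) :
    Relation.ReflTransGen M.FlowStep c' c := by
  induction l' generalizing l with
  | nil => exact (reflTransGen_of_le hc' h).trans hl.reflTransGen
  | cons s t ih =>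
    rcases h.2 with ht | ⟨e, t', rfl, ht⟩
    · exact ih ht hl
    · exact ih ht hl.2

theorem Sub.target_eq {M : PartialMatching P} (hac : ∀ x, ¬ Relation.TransGen M.FlowStep x x)
    {c c' : P} {l l' : List (P × P)} (h : Sub c c' l' l) (h' : Sub c' c l l')
    (hl : IsFlow M c l) (hl' : IsFlow M c' l') : c = c' := by
  rcases Relation.reflTransGen_iff_eq_or_transGen.1 (h.reflTransGen hl hl'.critical) with e | h1
  · exact e
  · exact (hac _ (h1.trans_left (h'.reflTransGen hl' hl.critical))).elim

theorem Sub.length_le {M : PartialMatching P} (hac : ∀ x, ¬ Relation.TransGen M.FlowStep x x)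
    {c : P} {l l' : List (P × P)} (h : Sub c c l' l) (hl : IsFlow M c l) :
    l.length ≤ l'.length := by
  induction l' generalizing l with
  | nil =>
    cases l with
    | nil => exact le_rfl
    | cons s t =>
      exact (hac _ (hl.transGen_cons.trans_left (reflTransGen_of_le hl.critical h))).elim
  | cons s t ih =>
    rcases h.2 with ht | ⟨e, t', rfl, ht⟩
    · exact (ih ht hl).trans (Nat.le_succ _)
    · exact Nat.succ_le_succ (ih ht hl.2)

theorem Sub.antisymm_of_target_eq {M : PartialMatching P}
    (hac : ∀ x, ¬ Relation.TransGen M.FlowStep x x)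
    {c : P} {l l' : List (P × P)} (h : Sub c c l' l) (h' : Sub c c l l')
    (hl : IsFlow M c l) (hl' : IsFlow M c l') : l = l' := by
  induction l' generalizing l with
  | nil => exact List.length_eq_zero_iff.1 (Nat.le_zero.1 (h.length_le hac hl))
  | cons s t ih =>
    obtain ⟨e₀, u⟩ := s
    have hle := h'.length_le hac hl'
    rcases h.2 with h2 | ⟨e, t', rfl, h2⟩
    · exact absurd (h2.length_le hac hl) (by simp at hle; omega)
    · rcases h'.2 with h2' | ⟨e', t'', he, h2'⟩
      · exact absurd (h2'.length_le hac hl') (by simp at hle ⊢; have := h2.length_le hac hl.2; omega)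
      · obtain ⟨-, rfl⟩ := List.cons.inj he
        rw [ih h2 h2' hl.2 hl'.2, show e = e₀ from le_antisymm h.1 h'.1]

theorem eq_of_subpath {M : PartialMatching P} (hac : ∀ x, ¬ Relation.TransGen M.FlowStep x x)
    {γ δ : FlowPath P} (h : Subpath γ δ) (h' : Subpath δ γ) (hγ : Valid M γ) (hδ : Valid M δ) :
    γ = δ := by
  obtain ⟨l, c⟩ := γ
  obtain ⟨l', c'⟩ := δ
  rw [subpath_iff] at h h'
  rw [valid_iff] at hγ hδ
  obtain rfl := h.target_eq hac h' hγ hδ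
  rw [h.antisymm_of_target_eq hac h' hγ hδ]

theorem RedStep.sub {M : PartialMatching P} {c : P} {l l' : List (P × P)}
    (h : RedStep M c l l') (hl : IsFlow M c l) : Sub c c l l' := by
  induction h with
  | head e u t h =>
    exact ⟨h.le.trans (M.minv_le_of_eq_or hl.1.1 hl.1.2.1), .inl (.refl c t)⟩
  | cons s h ih => exact ⟨le_rfl, .inr ⟨_, _, rfl, ih hl.2⟩⟩

theorem RedStep.isFlow {M : PartialMatching P} {c : P} {l l' : List (P × P)}
    (h : RedStep M c l l') (hl : IsFlow M c l) : IsFlow M c l' := by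
  induction h with
  | head => exact hl.2
  | cons s h ih =>
    exact ⟨⟨hl.1.1, hl.1.2.1, M.lt_and_ne_minv_of_le hl.1.1 (h.sub hl.2).ini_le hl.1.2.2.1
      hl.1.2.2.2⟩, ih hl.2⟩

theorem RedStep.length_lt {M : PartialMatching P} {c : P} {l l' : List (P × P)}
    (h : RedStep M c l l') : l'.length < l.length := by
  induction h with
  | head => exact Nat.lt_succ_self _
  | cons s h ih => exact Nat.succ_lt_succ ih

theorem exists_redStep {M : PartialMatching P} {c : P} {l : List (P × P)}
    (h : ¬ IsRed M c l) : ∃ l', RedStep M c l l' := by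
  induction l with
  | nil => exact (h trivial).elim
  | cons s t ih =>
    by_cases h0 : ini c t < M.minv s.2
    · exact ⟨t, .head s.1 s.2 t h0⟩
    · obtain ⟨t', ht'⟩ := ih fun ht => h ⟨h0, ht⟩
      exact ⟨_, .cons s ht'⟩

/-- A reduced path below `l` stays below it when a reducible step of `l` is deleted. -/
theorem Sub.of_redStep {M : PartialMatching P} {c c' : P} {l l' k : List (P × P)}
    (h : Sub c c' l k) (hk : IsRed M c k) (hr : RedStep M c' l l') : Sub c c' l' k := by
  induction hr generalizing k with
  | head e u t hlt =>
    rcases h.2 with ht | ⟨e', t', rfl, ht⟩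
    · exact ht
    · exact (hk.1 (ht.ini_le.trans_lt hlt)).elim
  | cons s hr ih =>
    refine ⟨h.1, ?_⟩
    rcases h.2 with ht | ⟨e', t', rfl, ht⟩
    · exact .inl (ih ht hk)
    · exact .inr ⟨_, _, rfl, ih ht hk.2⟩

theorem Sub.of_reds {M : PartialMatching P} {c c' : P} {l l' k : List (P × P)}
    (h : Sub c c' l k) (hk : IsRed M c k) (hr : Relation.ReflTransGen (RedStep M c') l l') :
    Sub c c' l' k := by
  induction hr with
  | refl => exact h
  | tail _ hr ih => exact ih.of_redStep hk hr

theorem isFlow_and_sub_of_reds {M : PartialMatching P} {c : P} {l l' : List (P × P)}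
    (hr : Relation.ReflTransGen (RedStep M c) l l') (hl : IsFlow M c l) :
    IsFlow M c l' ∧ Sub c c l l' := by
  induction hr with
  | refl => exact ⟨hl, .refl c l⟩
  | tail _ hr ih => exact ⟨hr.isFlow ih.1, (hr.sub ih.1).trans ih.2⟩

theorem exists_reds_isRed (M : PartialMatching P) (c : P) (l : List (P × P)) :
    ∃ l', Relation.ReflTransGen (RedStep M c) l l' ∧ IsRed M c l' := by
  induction hn : l.length using Nat.strong_induction_on generalizing l with
  | _ n ih =>
    by_cases h : IsRed M c l
    · exact ⟨l, .refl, h⟩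
    · obtain ⟨l₁, h₁⟩ := exists_redStep h
      obtain ⟨l', h', hred⟩ := ih _ (hn ▸ h₁.length_lt) l₁ rfl
      exact ⟨l', .head h₁ h', hred⟩

/-- The reduction is reached by deleting reducible steps, and keeps the target. -/
theorem IsReduction.exists_reds {M : PartialMatching P}
    (hac : ∀ x, ¬ Relation.TransGen M.FlowStep x x) {c : P} {l : List (P × P)} {ρ : FlowPath P}
    (h : IsReduction M ⟨l, c⟩ ρ) (hl : IsFlow M c l) :
    ∃ l', ρ = ⟨l', c⟩ ∧ Relation.ReflTransGen (RedStep M c) l l' := by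
  obtain ⟨l', hr, hred⟩ := exists_reds_isRed M c l
  obtain ⟨hl', hsub⟩ := isFlow_and_sub_of_reds hr hl
  obtain ⟨hv, hρ, hs, hmax⟩ := h
  have h1 : Subpath ⟨l', c⟩ ρ :=
    hmax _ ((valid_iff M c l').2 hl') ((reduced_iff M c l').2 hred) (subpath_iff.2 hsub)
  have h2 : Subpath ρ ⟨l', c⟩ :=
    subpath_iff.2 ((subpath_iff.1 hs).of_reds ((reduced_iff M _ _).1 hρ) hr)
  exact ⟨l', eq_of_subpath hac h2 h1 hv ((valid_iff M c l').2 hl'), hr⟩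

theorem ini_append_le {c c' : P} (l k : List (P × P)) (h : ini c' k ≤ c) :
    ini c' (l ++ k) ≤ ini c l := by
  cases l with
  | nil => exact h
  | cons s t => exact le_rfl

theorem IsFlow.append {M : PartialMatching P} {c c' : P} {l k : List (P × P)}
    (hl : IsFlow M c l) (hk : IsFlow M c' k) (h : ini c' k ≤ c) : IsFlow M c' (l ++ k) := by
  induction l with
  | nil => exact hk
  | cons s t ih =>
    exact ⟨⟨hl.1.1, hl.1.2.1, M.lt_and_ne_minv_of_le hl.1.1 (ini_append_le t k h) hl.1.2.2.1
      hl.1.2.2.2⟩, ih hl.2⟩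

theorem RedStep.append_right {M : PartialMatching P} {c c' : P} {l l' k : List (P × P)}
    (hr : RedStep M c l l') (h : ini c' k ≤ c) : RedStep M c' (l ++ k) (l' ++ k) := by
  induction hr with
  | head e u t hlt => exact .head e u _ ((ini_append_le t k h).trans_lt hlt)
  | cons s _ ih => exact .cons s ih

theorem RedStep.append_left {M : PartialMatching P} {c : P} {l l' : List (P × P)}
    (hr : RedStep M c l l') (k : List (P × P)) : RedStep M c (k ++ l) (k ++ l') := by
  induction k with
  | nil => exact hr
  | cons s _ ih => exact .cons s ih

/-- Deleting reducible steps does not change the reduction. -/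
theorem subpath_of_isReduction {M : PartialMatching P} {c : P} {l l₁ l₂ : List (P × P)}
    (hl : IsFlow M c l) (hr₁ : Relation.ReflTransGen (RedStep M c) l l₁)
    (hr₂ : Relation.ReflTransGen (RedStep M c) l l₂) {a b : FlowPath P}
    (ha : IsReduction M ⟨l₁, c⟩ a) (hb : IsReduction M ⟨l₂, c⟩ b) : Subpath a b := by
  obtain ⟨hv, hred, hsub, -⟩ := ha
  exact hb.2.2.2 a hv hred (subpath_iff.2
    (((subpath_iff.1 hsub).trans (isFlow_and_sub_of_reds hr₁ hl).2).of_reds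
      ((reduced_iff M _ _).1 hred) hr₂))

end FlowPath

/-- `r(γ₁ * γ₂)` and `γ₃` are composable, `γ₁` and `r(γ₂ * γ₃)` are
composable, and `r(r(γ₁ * γ₂) * γ₃) = r(γ₁ * r(γ₂ * γ₃))` (associativity of the
reduced composition). -/
theorem stmt15 {P : Type} [PartialOrder P] [Fintype P]
    (rk : P → ℕ) (hrk : ∀ a b : P, a ⋖ b → rk b = rk a + 1)
    (M : PartialMatching P) (hM : M.IsAcyclic)
    (γ₁ γ₂ γ₃ ρ₁₂ ρ₂₃ : FlowPath P)
    (h₁ : γ₁.Valid M) (h₂ : γ₂.Valid M) (h₃ : γ₃.Valid M)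
    (hc₁₂ : γ₂.init < γ₁.tgt) (hc₂₃ : γ₃.init < γ₂.tgt)
    (hρ₁₂ : FlowPath.IsReduction M (γ₁.concat γ₂) ρ₁₂)
    (hρ₂₃ : FlowPath.IsReduction M (γ₂.concat γ₃) ρ₂₃) :
    γ₃.init < ρ₁₂.tgt ∧ ρ₂₃.init < γ₁.tgt ∧
    ∀ a b : FlowPath P, FlowPath.IsReduction M (ρ₁₂.concat γ₃) a →
      FlowPath.IsReduction M (γ₁.concat ρ₂₃) b → a = b := by
  have hac := hM.not_transGen_flowStep hrk
  obtain ⟨l₁, c₁⟩ := γ₁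
  obtain ⟨l₂, c₂⟩ := γ₂
  obtain ⟨l₃, c₃⟩ := γ₃
  rw [FlowPath.valid_iff] at h₁ h₂ h₃
  rw [FlowPath.init_mk] at hc₁₂ hc₂₃
  have h₁₂ := h₁.append h₂ hc₁₂.le
  have h₂₃ := h₂.append h₃ hc₂₃.le
  obtain ⟨r₁₂, rfl, hr₁₂⟩ := hρ₁₂.exists_reds hac h₁₂
  obtain ⟨r₂₃, rfl, hr₂₃⟩ := hρ₂₃.exists_reds hac h₂₃
  have hc' : FlowPath.ini c₃ (l₂ ++ l₃) < c₁ :=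
    (FlowPath.ini_append_le l₂ l₃ hc₂₃.le).trans_lt hc₁₂
  refine ⟨by rwa [FlowPath.init_mk], ?_, fun a b ha hb => ?_⟩
  · rw [FlowPath.init_mk]
    exact (FlowPath.isFlow_and_sub_of_reds hr₂₃ h₂₃).2.ini_le.trans_lt hc'
  · have h₁₂₃ := h₁.append h₂₃ hc'.le
    have hra : Relation.ReflTransGen (FlowPath.RedStep M c₃) (l₁ ++ (l₂ ++ l₃)) (r₁₂ ++ l₃) := by
      rw [← List.append_assoc]
      exact hr₁₂.lift (· ++ l₃) fun _ _ h => h.append_right hc₂₃.le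
    have hrb : Relation.ReflTransGen (FlowPath.RedStep M c₃) (l₁ ++ (l₂ ++ l₃)) (l₁ ++ r₂₃) :=
      hr₂₃.lift (l₁ ++ ·) fun _ _ h => h.append_left l₁
    exact FlowPath.eq_of_subpath hac (FlowPath.subpath_of_isReduction h₁₂₃ hra hrb ha hb)
      (FlowPath.subpath_of_isReduction h₁₂₃ hrb hra hb ha) ha.1 hb.1
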